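/- Let X be a topological space and x ∈ X. Then the union of all maximal finitely non-Hausdorff subsets of X that contain x is a closed subset of X. -/

import Mathlib

open Cardinal Set

/-- A nonempty subset `A` of a topological space is finitely non-Hausdorff if for every
nonempty finite subset `F` of `A` and every choice of open neighborhoods of the points
of `F`, the intersection of these neighborhoods is nonempty. -/
def FinNonHausdorff (X : Type*) [TopologicalSpace X] (A : Set X) : Prop :=
  A.Nonempty ∧ ∀ F : Finset X, (F : Set X) ⊆ A → F.Nonempty →
    ∀ U : X → Set X, (∀ x ∈ F, IsOpen (U x) ∧ x ∈ U x) →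
      (⋂ x ∈ F, U x).Nonempty

/-- A maximal finitely non-Hausdorff subset. -/
def MaxFinNonHausdorff (X : Type*) [TopologicalSpace X] (A : Set X) : Prop :=
  FinNonHausdorff X A ∧ ∀ B : Set X, FinNonHausdorff X B → A ⊆ B → A = B

/-- The non-Hausdorff number `nh(X)`. -/
noncomputable def nh (X : Type*) [TopologicalSpace X] : Cardinal :=
  1 + ⨆ A : {A : Set X // FinNonHausdorff X A}, #A.1

/-- A nonempty subset `A` is finitely non-Urysohn if for every nonempty finite subset `F`
of `A` and every choice of open neighborhoods of the points of `F`, the intersection of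
the closures of these neighborhoods is nonempty. -/
def FinNonUrysohn (X : Type*) [TopologicalSpace X] (A : Set X) : Prop :=
  A.Nonempty ∧ ∀ F : Finset X, (F : Set X) ⊆ A → F.Nonempty →
    ∀ U : X → Set X, (∀ x ∈ F, IsOpen (U x) ∧ x ∈ U x) →
      (⋂ x ∈ F, closure (U x)).Nonempty

/-- The non-Urysohn number `nu(X)`. -/
noncomputable def nu (X : Type*) [TopologicalSpace X] : Cardinal :=
  1 + ⨆ A : {A : Set X // FinNonUrysohn X A}, #A.1

/-- The θ-closure of the singleton `{x}`. -/
def thetaClosSingleton (X : Type*) [TopologicalSpace X] (x : X) : Set X :=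
  {y | ∀ U : Set X, IsOpen U → y ∈ U → x ∈ closure U}

/-- The non-Urysohn number of `X` with respect to singletons, `nu_s(X)`. -/
noncomputable def nuS (X : Type*) [TopologicalSpace X] : Cardinal :=
  1 + ⨆ x : X, #(thetaClosSingleton X x)

/-- The cellularity `c(X)`. -/
noncomputable def cellularity (X : Type*) [TopologicalSpace X] : Cardinal :=
  ℵ₀ + ⨆ 𝒰 : {𝒰 : Set (Set X) //
      (∀ U ∈ 𝒰, IsOpen U ∧ U.Nonempty) ∧ 𝒰.PairwiseDisjoint id}, #𝒰.1

/-- The character `χ(X)`. -/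
noncomputable def character (X : Type*) [TopologicalSpace X] : Cardinal :=
  ⨆ x : X, sInf {c : Cardinal | ∃ B : Set (Set X), #B = c ∧
    (∀ U ∈ B, IsOpen U ∧ x ∈ U) ∧ ∀ V : Set X, IsOpen V → x ∈ V → ∃ U ∈ B, U ⊆ V}

/-- The spread `s(X)`. -/
noncomputable def spread (X : Type*) [TopologicalSpace X] : Cardinal :=
  ℵ₀ + ⨆ D : {D : Set X // DiscreteTopology D}, #D.1

/-- The pseudocharacter `ψ(X)` of a `T₁` space. -/
noncomputable def pseudoCharacter (X : Type*) [TopologicalSpace X] : Cardinal :=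
  ⨆ x : X, sInf {c : Cardinal | ∃ S : Set (Set X), #S = c ∧
    (∀ U ∈ S, IsOpen U) ∧ ⋂₀ S = {x}}

/-- Two points whose neighborhoods always meet form a finitely non-Hausdorff set. -/
theorem finNonHausdorff_pair {X : Type*} [TopologicalSpace X] {x y : X}
    (h : ∀ U V : Set X, IsOpen U → x ∈ U → IsOpen V → y ∈ V → (U ∩ V).Nonempty) :
    FinNonHausdorff X {x, y} := by
  classical
  refine ⟨⟨x, by simp⟩, fun F hF _ U hU => ?_⟩
  have key : ∀ z : X, IsOpen (if z ∈ F then U z else univ) ∧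
      z ∈ (if z ∈ F then U z else univ) := by
    intro z
    split_ifs with hz
    · exact hU z hz
    · exact ⟨isOpen_univ, mem_univ z⟩
  obtain ⟨p, hpx, hpy⟩ := h _ _ (key x).1 (key x).2 (key y).1 (key y).2
  refine ⟨p, mem_iInter₂.2 fun z hz => ?_⟩
  rcases hF hz with rfl | rfl
  · rwa [if_pos hz] at hpx
  · rwa [if_pos hz] at hpy

/-- Neighborhoods of two points of a finitely non-Hausdorff set meet. -/
theorem FinNonHausdorff.inter_nonempty {X : Type*} [TopologicalSpace X] {A : Set X}
    (hA : FinNonHausdorff X A) {x y : X} (hx : x ∈ A) (hy : y ∈ A) {U V : Set X}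
    (hU : IsOpen U) (hxU : x ∈ U) (hV : IsOpen V) (hyV : y ∈ V) : (U ∩ V).Nonempty := by
  classical
  rcases eq_or_ne y x with rfl | hne
  · exact ⟨y, hxU, hyV⟩
  obtain ⟨p, hp⟩ := hA.2 {x, y} (by simp [insert_subset_iff, hx, hy]) (by simp)
    (fun w => if w = x then U else V) (by simp [hne, hU, hxU, hV, hyV])
  refine ⟨p, ?_⟩
  simpa [hne] using hp

/-- Every finitely non-Hausdorff set is contained in a maximal one. -/
theorem FinNonHausdorff.exists_maximal {X : Type*} [TopologicalSpace X] {A : Set X}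
    (hA : FinNonHausdorff X A) : ∃ M, A ⊆ M ∧ MaxFinNonHausdorff X M := by
  obtain ⟨M, hAM, hM⟩ := zorn_subset_nonempty {B | FinNonHausdorff X B} (by
    intro c hc hchain hne
    refine ⟨⋃₀ c, ⟨?_, fun F hF hFne U hU => ?_⟩, fun s => subset_sUnion_of_mem⟩
    · obtain ⟨s, hs⟩ := hne
      exact (hc hs).1.mono (subset_sUnion_of_mem hs)
    · obtain ⟨s, hs, hFs⟩ := hchain.directedOn.exists_mem_subset_of_finite_of_subset_sUnion
        hne F.finite_toSet hF
      exact (hc hs).2 F hFs hFne U hU) A hA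
  exact ⟨M, hAM, hM.prop, fun B hB hMB => hM.eq_of_subset hB hMB⟩

theorem statement16 (X : Type*) [TopologicalSpace X] (x : X) :
    IsClosed (⋃ (M : Set X) (_ : MaxFinNonHausdorff X M ∧ x ∈ M), M) := by
  refine isClosed_of_closure_subset fun y hy => ?_
  have hpair : FinNonHausdorff X {x, y} := by
    refine finNonHausdorff_pair fun U V hU hxU hV hyV => ?_
    obtain ⟨z, hzV, hz⟩ := mem_closure_iff.1 hy V hV hyV
    obtain ⟨M, ⟨hM, hxM⟩, hzM⟩ := mem_iUnion₂.1 hz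
    exact hM.1.inter_nonempty hxM hzM hU hxU hV hzV
  obtain ⟨M, hsub, hM⟩ := hpair.exists_maximal
  exact mem_iUnion₂.2 ⟨M, ⟨hM, hsub (by simp)⟩, hsub (by simp)⟩
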